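/- Let T be any continuous t-norm on [0,1] and u ∈ [0,1]. Then the function t ↦ u_T^(t) is continuous on (0,∞). -/

import Mathlib

open Set

/-- A t-norm on `[0,1]`: commutative, associative, nondecreasing in each argument,
with neutral element `1`. -/
structure IsTnorm (T : ℝ → ℝ → ℝ) : Prop where
  maps_to : ∀ x ∈ Icc (0:ℝ) 1, ∀ y ∈ Icc (0:ℝ) 1, T x y ∈ Icc (0:ℝ) 1
  comm : ∀ x ∈ Icc (0:ℝ) 1, ∀ y ∈ Icc (0:ℝ) 1, T x y = T y x
  assoc : ∀ x ∈ Icc (0:ℝ) 1, ∀ y ∈ Icc (0:ℝ) 1, ∀ z ∈ Icc (0:ℝ) 1,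
    T (T x y) z = T x (T y z)
  mono : ∀ x ∈ Icc (0:ℝ) 1, ∀ y ∈ Icc (0:ℝ) 1, ∀ z ∈ Icc (0:ℝ) 1,
    y ≤ z → T x y ≤ T x z
  one : ∀ x ∈ Icc (0:ℝ) 1, T x 1 = x

/-- A t-conorm on `[0,1]`: commutative, associative, nondecreasing in each argument,
with neutral element `0`. -/
structure IsTconorm (S : ℝ → ℝ → ℝ) : Prop where
  maps_to : ∀ x ∈ Icc (0:ℝ) 1, ∀ y ∈ Icc (0:ℝ) 1, S x y ∈ Icc (0:ℝ) 1
  comm : ∀ x ∈ Icc (0:ℝ) 1, ∀ y ∈ Icc (0:ℝ) 1, S x y = S y x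
  assoc : ∀ x ∈ Icc (0:ℝ) 1, ∀ y ∈ Icc (0:ℝ) 1, ∀ z ∈ Icc (0:ℝ) 1,
    S (S x y) z = S x (S y z)
  mono : ∀ x ∈ Icc (0:ℝ) 1, ∀ y ∈ Icc (0:ℝ) 1, ∀ z ∈ Icc (0:ℝ) 1,
    y ≤ z → S x y ≤ S x z
  zero : ∀ x ∈ Icc (0:ℝ) 1, S x 0 = x

/-- Continuity of a binary operation on the unit square. -/
def ContinuousOn2 (T : ℝ → ℝ → ℝ) : Prop :=
  ContinuousOn (fun p : ℝ × ℝ => T p.1 p.2) (Icc (0:ℝ) 1 ×ˢ Icc (0:ℝ) 1)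

/-- `n`-fold power `u_T^(n)` with respect to a t-norm: `u_T^(0) = 1`,
`u_T^(n+1) = T (u_T^(n)) u`. -/
def Tpow (T : ℝ → ℝ → ℝ) (u : ℝ) : ℕ → ℝ
  | 0 => 1
  | n + 1 => T (Tpow T u n) u

/-- `n`-fold power `u_S^(n)` with respect to a t-conorm: `u_S^(0) = 0`,
`u_S^(n+1) = S (u_S^(n)) u`. -/
def Spow (S : ℝ → ℝ → ℝ) (u : ℝ) : ℕ → ℝ
  | 0 => 0
  | n + 1 => S (Spow S u n) u

/-- `p`-th root `u_T^(1/p) = sup {v ∈ [0,1] | v_T^(p) < u}`. -/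
noncomputable def Troot (T : ℝ → ℝ → ℝ) (u : ℝ) (p : ℕ) : ℝ :=
  sSup {v ∈ Icc (0:ℝ) 1 | Tpow T v p < u}

/-- `p`-th root `u_S^(1/p) = inf {v ∈ [0,1] | v_S^(p) > u}`. -/
noncomputable def Sroot (S : ℝ → ℝ → ℝ) (u : ℝ) (p : ℕ) : ℝ :=
  sInf {v ∈ Icc (0:ℝ) 1 | u < Spow S v p}

/-- Rational power `u_T^(q/p) = (u_T^(1/p))_T^(q)`, with `r = q/p` in lowest terms. -/
noncomputable def TratPow (T : ℝ → ℝ → ℝ) (u : ℝ) (r : ℚ) : ℝ :=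
  Tpow T (Troot T u r.den) r.num.toNat

/-- Rational power `u_S^(q/p) = (u_S^(1/p))_S^(q)`, with `r = q/p` in lowest terms. -/
noncomputable def SratPow (S : ℝ → ℝ → ℝ) (u : ℝ) (r : ℚ) : ℝ :=
  Spow S (Sroot S u r.den) r.num.toNat

/-- Real power `u_T^(t) = inf {u_T^(r) | r ∈ [0,t] ∩ ℚ}`. -/
noncomputable def TrePow (T : ℝ → ℝ → ℝ) (u : ℝ) (t : ℝ) : ℝ :=
  sInf (TratPow T u '' {r : ℚ | 0 ≤ r ∧ (r : ℝ) ≤ t})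

/-- Real power `u_S^(t) = sup {u_S^(r) | r ∈ [0,t] ∩ ℚ}`. -/
noncomputable def SrePow (S : ℝ → ℝ → ℝ) (u : ℝ) (t : ℝ) : ℝ :=
  sSup (SratPow S u '' {r : ℚ | 0 ≤ r ∧ (r : ℝ) ≤ t})

/-- A t-norm is Archimedean if for all `x, y ∈ (0,1)` there is `n` with `x_T^(n) < y`. -/
def TnormArchimedean (T : ℝ → ℝ → ℝ) : Prop :=
  ∀ x ∈ Ioo (0:ℝ) 1, ∀ y ∈ Ioo (0:ℝ) 1, ∃ n : ℕ, Tpow T x n < y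

/-- Strict monotonicity of a t-norm: `T x y < T x z` whenever `x > 0` and `y < z`. -/
def TnormStrictMono (T : ℝ → ℝ → ℝ) : Prop :=
  ∀ x ∈ Icc (0:ℝ) 1, 0 < x → ∀ y ∈ Icc (0:ℝ) 1, ∀ z ∈ Icc (0:ℝ) 1, y < z → T x y < T x z

/-- Pseudo-inverse of a decreasing `G : [0,1] → [0,∞]`:
`G^(−1)(y) = sup {x ∈ [0,1] | G x > y}`. -/
noncomputable def pseudoInv (G : ℝ → ENNReal) (y : ENNReal) : ℝ :=
  sSup {x ∈ Icc (0:ℝ) 1 | y < G x}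

/-- `G : [0,1] → [0,∞]` is an additive generator of the t-norm `T`. -/
structure IsAddGen (T : ℝ → ℝ → ℝ) (G : ℝ → ENNReal) : Prop where
  strictAnti : StrictAntiOn G (Icc (0:ℝ) 1)
  rightContinuousAtZero : ContinuousWithinAt G (Icc (0:ℝ) 1) 0
  map_one : G 1 = 0
  sum_mem : ∀ x ∈ Icc (0:ℝ) 1, ∀ y ∈ Icc (0:ℝ) 1,
    G x + G y ∈ G '' Icc (0:ℝ) 1 ∪ Icc (G 0) ⊤
  eq_pseudoInv : ∀ x ∈ Icc (0:ℝ) 1, ∀ y ∈ Icc (0:ℝ) 1, T x y = pseudoInv G (G x + G y)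

open Filter Topology

namespace IsTnorm

variable {T : ℝ → ℝ → ℝ}

lemma mono₂ (hT : IsTnorm T) {x y z w : ℝ} (hx : x ∈ Icc (0:ℝ) 1) (hy : y ∈ Icc (0:ℝ) 1)
    (hz : z ∈ Icc (0:ℝ) 1) (hw : w ∈ Icc (0:ℝ) 1) (hxz : x ≤ z) (hyw : y ≤ w) :
    T x y ≤ T z w :=
  calc T x y ≤ T x w := hT.mono x hx y hy w hw hyw
    _ = T w x := hT.comm x hx w hw
    _ ≤ T w z := hT.mono w hw x hx z hz hxz
    _ = T z w := hT.comm w hw z hz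

lemma le_left (hT : IsTnorm T) {x y : ℝ} (hx : x ∈ Icc (0:ℝ) 1) (hy : y ∈ Icc (0:ℝ) 1) :
    T x y ≤ x :=
  (hT.mono x hx y hy 1 (by simp) hy.2).trans_eq (hT.one x hx)

lemma zero_right (hT : IsTnorm T) {x : ℝ} (hx : x ∈ Icc (0:ℝ) 1) : T x 0 = 0 := by
  have h0 : (0:ℝ) ∈ Icc (0:ℝ) 1 := by simp
  refine le_antisymm ?_ (hT.maps_to x hx 0 h0).1
  rw [hT.comm x hx 0 h0]
  exact hT.le_left h0 hx

lemma tpow_mem (hT : IsTnorm T) {v : ℝ} (hv : v ∈ Icc (0:ℝ) 1) (n : ℕ) :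
    Tpow T v n ∈ Icc (0:ℝ) 1 := by
  induction n with
  | zero => simp [Tpow]
  | succ n ih => exact hT.maps_to _ ih _ hv

lemma tpow_add (hT : IsTnorm T) {v : ℝ} (hv : v ∈ Icc (0:ℝ) 1) (m n : ℕ) :
    Tpow T v (m + n) = T (Tpow T v m) (Tpow T v n) := by
  induction n with
  | zero => exact (hT.one _ (hT.tpow_mem hv m)).symm
  | succ n ih =>
    calc Tpow T v (m + (n + 1)) = T (Tpow T v (m + n)) v := rfl
      _ = T (Tpow T v m) (T (Tpow T v n) v) := by
        rw [ih, hT.assoc _ (hT.tpow_mem hv m) _ (hT.tpow_mem hv n) _ hv]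

lemma tpow_mul (hT : IsTnorm T) {v : ℝ} (hv : v ∈ Icc (0:ℝ) 1) (m n : ℕ) :
    Tpow T v (m * n) = Tpow T (Tpow T v m) n := by
  induction n with
  | zero => rfl
  | succ n ih => rw [Nat.mul_succ, hT.tpow_add hv, ih]; rfl

lemma tpow_le_tpow_left (hT : IsTnorm T) {v w : ℝ} (hv : v ∈ Icc (0:ℝ) 1)
    (hw : w ∈ Icc (0:ℝ) 1) (hvw : v ≤ w) (n : ℕ) : Tpow T v n ≤ Tpow T w n := by
  induction n with
  | zero => exact le_rfl
  | succ n ih => exact hT.mono₂ (hT.tpow_mem hv n) hv (hT.tpow_mem hw n) hw ih hvw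

lemma continuousOn_tpow (hT : IsTnorm T) (hTc : ContinuousOn2 T) (n : ℕ) :
    ContinuousOn (fun v => Tpow T v n) (Icc (0:ℝ) 1) := by
  induction n with
  | zero => exact continuousOn_const
  | succ n ih =>
    exact hTc.comp (ih.prodMk continuousOn_id) fun v hv => ⟨hT.tpow_mem hv n, hv⟩

lemma exists_tpow_eq (hT : IsTnorm T) (hTc : ContinuousOn2 T) {u : ℝ} (hu : u ∈ Icc (0:ℝ) 1)
    {p : ℕ} (hp : p ≠ 0) : ∃ v ∈ Icc (0:ℝ) 1, Tpow T v p = u := by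
  have h0 : Tpow T 0 p = 0 := by
    obtain ⟨k, rfl⟩ := Nat.exists_eq_succ_of_ne_zero hp
    exact hT.zero_right (hT.tpow_mem (by simp) k)
  have h1 : Tpow T 1 p = 1 := by
    clear hp h0
    induction p with
    | zero => rfl
    | succ n ih => rw [Tpow, ih, hT.one 1 (by simp)]
  have h := intermediate_value_Icc zero_le_one (hT.continuousOn_tpow hTc p)
  rw [h0, h1] at h
  exact h hu

lemma troot_mem (u : ℝ) (p : ℕ) : Troot T u p ∈ Icc (0:ℝ) 1 :=
  ⟨Real.sSup_nonneg fun _ hv => hv.1.1, Real.sSup_le (fun _ hv => hv.1.2) zero_le_one⟩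

lemma troot_le (hT : IsTnorm T) {u v : ℝ} {p : ℕ} (hv : v ∈ Icc (0:ℝ) 1)
    (h : u ≤ Tpow T v p) : Troot T u p ≤ v := by
  refine Real.sSup_le (fun x hx => ?_) hv.1
  by_contra! hlt
  exact (hx.2.trans_le h).not_ge (hT.tpow_le_tpow_left hv hx.1 hlt.le p)

lemma tpow_troot (hT : IsTnorm T) (hTc : ContinuousOn2 T) {u : ℝ} (hu : u ∈ Icc (0:ℝ) 1)
    {p : ℕ} (hp : p ≠ 0) : Tpow T (Troot T u p) p = u := by
  have hw := troot_mem (T := T) u p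
  apply le_antisymm
  · obtain ⟨z, hz, hzu⟩ := hT.exists_tpow_eq hTc hu hp
    exact (hT.tpow_le_tpow_left hw hz (hT.troot_le hz hzu.ge) p).trans_eq hzu
  · by_contra! hlt
    obtain ⟨m, hm1, hm2⟩ := exists_between hlt
    obtain ⟨v, hv, rfl⟩ := hT.exists_tpow_eq hTc
      (u := m) ⟨(hT.tpow_mem hw p).1.trans hm1.le, hm2.le.trans hu.2⟩ hp
    have hvw : v ≤ Troot T u p := le_csSup ⟨1, fun x hx => hx.1.2⟩ ⟨hv, hm2⟩
    exact hm1.not_ge (hT.tpow_le_tpow_left hv hw hvw p)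

lemma tpow_troot_mul (hT : IsTnorm T) (hTc : ContinuousOn2 T) {u : ℝ} (hu : u ∈ Icc (0:ℝ) 1)
    {k p : ℕ} (hk : k ≠ 0) (hp : p ≠ 0) : Tpow T (Troot T u (k * p)) k = Troot T u p := by
  have hw := troot_mem (T := T) u (k * p)
  have hwp := troot_mem (T := T) u p
  apply le_antisymm
  · have hz := troot_mem (T := T) (Troot T u p) k
    have hzk := hT.tpow_troot hTc hwp hk
    refine (hT.tpow_le_tpow_left hw hz (hT.troot_le hz ?_) k).trans_eq hzk
    rw [hT.tpow_mul hz, hzk, hT.tpow_troot hTc hu hp]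
  · refine hT.troot_le (hT.tpow_mem hw k) ?_
    rw [← hT.tpow_mul hw, hT.tpow_troot hTc hu (mul_ne_zero hk hp)]

lemma tratPow_eq (hT : IsTnorm T) (hTc : ContinuousOn2 T) {u : ℝ} (hu : u ∈ Icc (0:ℝ) 1)
    {r : ℚ} {k N : ℕ} (hN : N ≠ 0) (hr : r = k / N) :
    TratPow T u r = Tpow T (Troot T u N) k := by
  obtain ⟨m, hm⟩ : r.den ∣ N := by
    have h := Rat.den_dvd k N
    rw [Rat.divInt_eq_div, Int.cast_natCast, Int.cast_natCast, ← hr] at h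
    exact_mod_cast h
  have hm0 : m ≠ 0 := by rintro rfl; exact hN (by simpa using hm)
  have hnum : k = m * r.num.toNat := by
    have hr0 : 0 ≤ r := hr ▸ by positivity
    have h1 : (r.num.toNat : ℤ) = r.num := Int.toNat_of_nonneg (Rat.num_nonneg.2 hr0)
    have h2 : (r.num.toNat : ℚ) = r * r.den := by
      rw [Rat.mul_den_eq_num]; exact_mod_cast congrArg (Int.cast (R := ℚ)) h1
    have h3 : (k : ℚ) = r * N := by
      rw [hr]; field_simp
    have h4 : (k : ℚ) = m * r.num.toNat := by
      rw [h2, h3, hm]; push_cast; ring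
    exact_mod_cast h4
  rw [TratPow, hnum, hT.tpow_mul (troot_mem u N), hm, mul_comm r.den m,
    hT.tpow_troot_mul hTc hu hm0 r.den_nz]

lemma tratPow_mem (hT : IsTnorm T) (u : ℝ) (r : ℚ) : TratPow T u r ∈ Icc (0:ℝ) 1 :=
  hT.tpow_mem (troot_mem _ _) _

lemma exists_common_den {r s : ℚ} (hr : 0 ≤ r) (hs : 0 ≤ s) :
    ∃ k l N : ℕ, N ≠ 0 ∧ r = k / N ∧ s = l / N := by
  lift r to ℚ≥0 using hr
  lift s to ℚ≥0 using hs
  refine ⟨r.num * s.den, s.num * r.den, r.den * s.den,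
    mul_ne_zero r.den_ne_zero s.den_ne_zero, ?_, ?_⟩
  · have h := congrArg (NNRat.cast (K := ℚ)) r.num_div_den
    have := s.den_ne_zero
    rw [← h]; push_cast; field_simp
  · have h := congrArg (NNRat.cast (K := ℚ)) s.num_div_den
    have := r.den_ne_zero
    rw [← h]; push_cast; field_simp

lemma tratPow_add (hT : IsTnorm T) (hTc : ContinuousOn2 T) {u : ℝ} (hu : u ∈ Icc (0:ℝ) 1)
    {r s : ℚ} (hr : 0 ≤ r) (hs : 0 ≤ s) :
    TratPow T u (r + s) = T (TratPow T u r) (TratPow T u s) := by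
  obtain ⟨k, l, N, hN, hrk, hsl⟩ := exists_common_den hr hs
  rw [hT.tratPow_eq hTc hu hN hrk, hT.tratPow_eq hTc hu hN hsl,
    hT.tratPow_eq hTc hu (k := k + l) hN (by rw [hrk, hsl]; push_cast; ring),
    hT.tpow_add (troot_mem u N)]

lemma tratPow_anti (hT : IsTnorm T) (hTc : ContinuousOn2 T) {u : ℝ} (hu : u ∈ Icc (0:ℝ) 1)
    {r s : ℚ} (hr : 0 ≤ r) (hrs : r ≤ s) : TratPow T u s ≤ TratPow T u r := by
  rw [← add_sub_cancel r s, hT.tratPow_add hTc hu hr (sub_nonneg.2 hrs)]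
  exact hT.le_left (hT.tratPow_mem u _) (hT.tratPow_mem u _)

/-- An idempotent of a continuous t-norm is neutral for every element below it. -/
lemma eq_of_le_idempotent (hT : IsTnorm T) (hTc : ContinuousOn2 T) {e x : ℝ}
    (he : e ∈ Icc (0:ℝ) 1) (hee : T e e = e) (hx : 0 ≤ x) (hxe : x ≤ e) : T x e = x := by
  have hc : ContinuousOn (fun y => T e y) (Icc (0:ℝ) 1) :=
    hTc.comp (continuousOn_const.prodMk continuousOn_id) fun y hy => ⟨he, hy⟩
  have h := intermediate_value_Icc zero_le_one hc
  simp only [hT.zero_right he, hT.one e he] at h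
  obtain ⟨y, hy, rfl⟩ := h ⟨hx, hxe⟩
  simp only
  rw [hT.comm _ (hT.maps_to e he y hy) e he, ← hT.assoc e he e he y hy, hee]

/-- Rational powers with exponents `1 / 2 ^ k` converge to an idempotent. -/
lemma exists_tendsto_tratPow (hT : IsTnorm T) (hTc : ContinuousOn2 T) {u : ℝ}
    (hu : u ∈ Icc (0:ℝ) 1) :
    ∃ e ∈ Icc (0:ℝ) 1, T e e = e ∧ (∀ r : ℚ, 0 < r → TratPow T u r ≤ e) ∧
      Tendsto (fun k : ℕ => TratPow T u ((1 / 2) ^ k)) atTop (𝓝 e) := by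
  set a : ℕ → ℝ := fun k => TratPow T u ((1 / 2) ^ k) with ha
  have hmem : ∀ k, a k ∈ Icc (0:ℝ) 1 := fun k => hT.tratPow_mem u _
  have hmono : Monotone a := fun i j hij =>
    hT.tratPow_anti hTc hu (by positivity)
      (pow_le_pow_of_le_one (by norm_num) (by norm_num) hij)
  have hbdd : BddAbove (range a) := ⟨1, by rintro _ ⟨k, rfl⟩; exact (hmem k).2⟩
  have hlim := tendsto_atTop_ciSup hmono hbdd
  set e := ⨆ k, a k
  have he : e ∈ Icc (0:ℝ) 1 := isClosed_Icc.mem_of_tendsto hlim (Eventually.of_forall hmem)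
  refine ⟨e, he, ?_, fun r hr => ?_, hlim⟩
  · have hsq : ∀ k, T (a (k + 1)) (a (k + 1)) = a k := fun k => by
      rw [ha, ← hT.tratPow_add hTc hu (by positivity) (by positivity)]
      congr 1
      ring
    have hlim' := hlim.comp (tendsto_add_atTop_nat 1)
    have hpair : Tendsto (fun k => (a (k + 1), a (k + 1))) atTop
        (𝓝[Icc (0:ℝ) 1 ×ˢ Icc (0:ℝ) 1] (e, e)) :=
      tendsto_nhdsWithin_iff.2 ⟨hlim'.prodMk_nhds hlim',
        Eventually.of_forall fun k => ⟨hmem _, hmem _⟩⟩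
    have h := (hTc (e, e) ⟨he, he⟩).tendsto.comp hpair
    refine tendsto_nhds_unique h (hlim.congr fun k => (hsq k).symm)
  · obtain ⟨k, hk⟩ := exists_pow_lt_of_lt_one hr (show (1 / 2 : ℚ) < 1 by norm_num)
    exact (hT.tratPow_anti hTc hu (by positivity) hk.le).trans (le_ciSup hbdd k)

lemma exists_tratPow_sub_lt (hT : IsTnorm T) (hTc : ContinuousOn2 T) {u : ℝ}
    (hu : u ∈ Icc (0:ℝ) 1) {ε : ℝ} (hε : 0 < ε) :
    ∃ d : ℚ, 0 < d ∧ ∀ r : ℚ, 0 < r → TratPow T u r - TratPow T u (r + d) < ε := by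
  obtain ⟨e, he, hee, hle, hlim⟩ := hT.exists_tendsto_tratPow hTc hu
  obtain ⟨δ, hδ, hunif⟩ := Metric.uniformContinuousOn_iff.1
    ((isCompact_Icc.prod isCompact_Icc).uniformContinuousOn_of_continuous hTc) ε hε
  obtain ⟨k, hk⟩ := (Metric.tendsto_nhds.1 hlim δ hδ).exists
  refine ⟨(1 / 2) ^ k, by positivity, fun r hr => ?_⟩
  have hr' := hT.tratPow_mem u r
  have h := hunif (TratPow T u r, e) ⟨hr', he⟩ (TratPow T u r, TratPow T u ((1 / 2) ^ k))
    ⟨hr', hT.tratPow_mem u _⟩ (by simpa [Prod.dist_eq, dist_comm e] using hk)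
  rw [hT.tratPow_add hTc hu hr.le (by positivity)]
  simp only [hT.eq_of_le_idempotent hTc he hee hr'.1 (hle r hr)] at h
  exact (le_abs_self _).trans_lt h

lemma trePow_le_tratPow (hT : IsTnorm T) (u : ℝ) {r : ℚ} {t : ℝ} (hr : 0 ≤ r)
    (hrt : (r : ℝ) ≤ t) : TrePow T u t ≤ TratPow T u r :=
  csInf_le ⟨0, by rintro _ ⟨s, -, rfl⟩; exact (hT.tratPow_mem u s).1⟩ ⟨r, ⟨hr, hrt⟩, rfl⟩

lemma tratPow_le_trePow (hT : IsTnorm T) (hTc : ContinuousOn2 T) {u : ℝ}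
    (hu : u ∈ Icc (0:ℝ) 1) {r : ℚ} {t : ℝ} (ht : 0 ≤ t) (htr : t ≤ r) :
    TratPow T u r ≤ TrePow T u t := by
  refine le_csInf ⟨_, 0, ⟨le_rfl, by simpa using ht⟩, rfl⟩ ?_
  rintro _ ⟨s, ⟨hs, hst⟩, rfl⟩
  exact hT.tratPow_anti hTc hu hs (by exact_mod_cast hst.trans htr)

end IsTnorm

/-- For any continuous t-norm `T` and `u ∈ [0,1]`, the function
`t ↦ u_T^(t)` is continuous on `(0,∞)`. -/
theorem realPow_continuousOn (T : ℝ → ℝ → ℝ) (hT : IsTnorm T) (hTc : ContinuousOn2 T)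
    (u : ℝ) (hu : u ∈ Icc (0:ℝ) 1) :
    ContinuousOn (fun t => TrePow T u t) (Ioi (0:ℝ)) := by
  intro t (ht : 0 < t)
  refine ContinuousAt.continuousWithinAt (Metric.tendsto_nhds.2 fun ε hε => ?_)
  obtain ⟨d, hd, hsub⟩ := hT.exists_tratPow_sub_lt hTc hu hε
  have hd' : (0:ℝ) < d := by exact_mod_cast hd
  obtain ⟨r, hr1, hr2⟩ := exists_rat_btwn (max_lt ht (sub_lt_self t hd'))
  have hr0 : 0 < r := by exact_mod_cast (le_max_left _ _).trans_lt hr1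
  have htr : t < r + d := sub_lt_iff_lt_add.1 ((le_max_right _ _).trans_lt hr1)
  have hbound : ∀ s ∈ Ioo (r:ℝ) (r + d),
      TrePow T u s ∈ Icc (TratPow T u (r + d)) (TratPow T u r) := fun s hs =>
    ⟨hT.tratPow_le_trePow hTc hu (le_trans (by exact_mod_cast hr0.le) hs.1.le)
      (by push_cast; exact hs.2.le), hT.trePow_le_tratPow u hr0.le hs.1.le⟩
  filter_upwards [Ioo_mem_nhds hr2 htr] with s hs
  exact (Real.dist_le_of_mem_Icc (hbound s hs) (hbound t ⟨hr2, htr⟩)).trans_lt (hsub r hr0)
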